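/- Let D ⊆ ℝ^d be a compact set with nonempty interior, and suppose there is a constant c > 0 (possibly depending on D) such that λₙ(x,D) ≤ c·λ₂ₙ(x,D) for every integer n ≥ 1 and every x ∈ D. Then D possesses optimal polynomial meshes: there exist constants μ, ν > 0 such that for every n ≥ 1 there is a finite set Yₙ ⊆ D of cardinality at most μ·n^d with max_{y∈D} |p(y)| ≤ ν · max_{y∈Yₙ} |p(y)| for every real polynomial p in d variables of total degree ≤ n. -/

import Mathlib

open MeasureTheory Set Pointwise

noncomputable section

abbrev E (d : ℕ) := EuclideanSpace ℝ (Fin d)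
abbrev E2 := EuclideanSpace ℝ (Fin 2)

/-- The Christoffel function `λ_n(x, D)` for Lebesgue measure on `D ⊆ ℝ^d`. -/
noncomputable def christoffel (d n : ℕ) (x : E d) (D : Set (E d)) : ℝ :=
  sInf { r : ℝ | ∃ p : MvPolynomial (Fin d) ℝ, p.totalDegree ≤ n ∧
    MvPolynomial.eval (fun i => x i) p = 1 ∧
    r = ∫ y in D, (MvPolynomial.eval (fun i => y i) p) ^ 2 }

/-- Determinant of the linear part of an affine automorphism of `ℝ^d`. -/
noncomputable def adet {d : ℕ} (T : E d ≃ᵃ[ℝ] E d) : ℝ :=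
  LinearMap.det (T.linear : E d →ₗ[ℝ] E d)

/-- The closed unit ball `B` of `ℝ²`. -/
def ballE : Set E2 := Metric.closedBall 0 1

/-- The unit square `S = [0,1]²` in `ℝ²`. -/
def squareS : Set E2 := {y : E2 | y 0 ∈ Icc (0:ℝ) 1 ∧ y 1 ∈ Icc (0:ℝ) 1}

/-- The geometric quantity `L(x, D)`. -/
noncomputable def Lfun (x : E2) (D : Set E2) : ℝ :=
  sSup { r : ℝ | ∃ T : E2 ≃ᵃ[ℝ] E2, x ∈ T '' ballE ∧ T '' ballE ⊆ D ∧
    r = Real.sqrt (1 - ‖T.symm x‖) * |adet T| }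

/-- The geometric quantity `U(x, D)`. -/
noncomputable def Ufun (x : E2) (D : Set E2) : ℝ :=
  sInf { r : ℝ | ∃ T : E2 ≃ᵃ[ℝ] E2, x ∈ T '' ((2:ℝ)⁻¹ • squareS) ∧ D ⊆ T '' squareS ∧
    r = Real.sqrt ((T.symm x) 0 * (T.symm x) 1) * |adet T| }

/-- A convex body in `ℝ²`: a compact convex set with nonempty interior. -/
def IsConvexBody (D : Set E2) : Prop := Convex ℝ D ∧ IsCompact D ∧ (interior D).Nonempty

/-- The point `(a, b)` of `ℝ²`. -/
noncomputable def e2 (a b : ℝ) : E2 := (WithLp.equiv 2 (Fin 2 → ℝ)).symm ![a, b]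

/-- Tchakaloff-type statement: the mean of a continuous map with values in a finite-dimensional
space over a compact set of positive finite measure is a convex combination of at most
`finrank + 1` values. -/
theorem exists_setAverage_eq_sum {X V : Type*} [TopologicalSpace X] [T2Space X]
    [MeasurableSpace X] [OpensMeasurableSpace X]
    [NormedAddCommGroup V] [NormedSpace ℝ V] [FiniteDimensional ℝ V]
    (ρ : Measure X) [IsFiniteMeasureOnCompacts ρ] {K : Set X} (hK : IsCompact K) (hρ : ρ K ≠ 0)
    {f : X → V} (hf : Continuous f) :
    ∃ (w : Fin (Module.finrank ℝ V + 1) → ℝ) (y : Fin (Module.finrank ℝ V + 1) → X),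
      (∀ i, 0 ≤ w i) ∧ (∀ i, y i ∈ K) ∧ ⨍ x in K, f x ∂ρ = ∑ i, w i • f (y i) := by
  set N := Module.finrank ℝ V + 1
  let S : Set V := (fun q : (Fin N → ℝ) × (Fin N → X) => ∑ i, q.1 i • f (q.2 i)) ''
    (stdSimplex ℝ (Fin N) ×ˢ Set.univ.pi fun _ => K)
  have hS : IsClosed S := by
    refine (((isCompact_stdSimplex ℝ (Fin N)).prod
      (isCompact_univ_pi fun _ => hK)).image ?_).isClosed
    fun_prop
  have hsub : convexHull ℝ (f '' K) ⊆ S := by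
    intro v hv
    obtain ⟨ι, _, z, w, hz, hai, hw, hw1, hsum⟩ := eq_pos_convex_span_of_mem_convexHull hv
    choose y hyK hyz using fun i => hz (mem_range_self i)
    obtain ⟨x₀, hx₀⟩ : K.Nonempty := nonempty_of_measure_ne_zero hρ
    have hcard : Fintype.card ι ≤ Fintype.card (Fin N) := by
      rw [Fintype.card_fin]
      exact hai.card_le_finrank_succ.trans
        (Nat.succ_le_succ (Submodule.finrank_le _))
    obtain ⟨e⟩ := Function.Embedding.nonempty_of_card_le hcard
    have hout : ∀ j ∉ range e, Function.extend e w (0 : Fin N → ℝ) j = 0 := fun j hj =>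
      Function.extend_apply' w (0 : Fin N → ℝ) j fun ⟨i, hi⟩ => hj ⟨i, hi⟩
    refine ⟨(Function.extend e w (0 : Fin N → ℝ), Function.extend e y fun _ => x₀), ⟨⟨fun j => ?_, ?_⟩, ?_⟩, ?_⟩
    · by_cases hj : j ∈ range e
      · obtain ⟨i, rfl⟩ := hj
        simpa [e.injective.extend_apply] using (hw i).le
      · exact (hout j hj).ge
    · rw [← hw1]
      exact (Fintype.sum_of_injective e e.injective _ _ hout
        fun i => (e.injective.extend_apply w _ i).symm).symm
    · intro j _
      by_cases hj : j ∈ range e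
      · obtain ⟨i, rfl⟩ := hj
        simpa [e.injective.extend_apply] using hyK i
      · simpa [Function.extend_apply' y _ j fun ⟨i, hi⟩ => hj ⟨i, hi⟩] using hx₀
    · rw [← hsum]
      refine (Fintype.sum_of_injective e e.injective _ _ (fun j hj => ?_) fun i => ?_).symm
      · simp [hout j hj]
      · simp [e.injective.extend_apply, hyz]
  have hmem : ⨍ x in K, f x ∂ρ ∈ S := by
    refine closure_minimal hsub hS ((convex_convexHull ℝ _).set_average_mem_closure hρ
      hK.measure_lt_top.ne ?_ (hf.continuousOn.integrableOn_compact' hK hK.measurableSet))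
    filter_upwards [ae_restrict_mem hK.measurableSet] with x hx
    exact subset_convexHull ℝ _ (mem_image_of_mem f hx)
  obtain ⟨⟨w, y⟩, ⟨hw, hy⟩, h⟩ := hmem
  exact ⟨w, y, hw.1, fun i => hy i (mem_univ i), h.symm⟩

theorem continuous_eval_polynomial {d : ℕ} (p : MvPolynomial (Fin d) ℝ) :
    Continuous fun y : E d => MvPolynomial.eval (fun i => y i) p :=
  p.continuous_eval.comp (by fun_prop)

/-- Exact positive quadrature for polynomials of degree at most `m` on a compact set. -/
theorem exists_quadrature {d : ℕ} {D : Set (E d)} (hDc : IsCompact D)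
    (hD : volume D ≠ 0) (m : ℕ) :
    ∃ (N : ℕ) (w : Fin N → ℝ) (y : Fin N → E d), N ≤ (m + 1) ^ d + 1 ∧
      (∀ i, 0 ≤ w i) ∧ (∀ i, y i ∈ D) ∧
      ∀ p : MvPolynomial (Fin d) ℝ, p.totalDegree ≤ m →
        ∫ x in D, MvPolynomial.eval (fun i => x i) p =
          ∑ j, w j * MvPolynomial.eval (fun i => y j i) p := by
  let Φ : E d → ((Fin d → Fin (m + 1)) → ℝ) := fun x α => ∏ i, x i ^ (α i : ℕ)
  have hΦ : Continuous Φ := by fun_prop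
  obtain ⟨w, y, hw, hy, h⟩ := exists_setAverage_eq_sum volume hDc hD hΦ
  have hV : 0 < volume.real D := ENNReal.toReal_pos hD hDc.measure_lt_top.ne
  refine ⟨_, fun j => volume.real D * w j, y, by simp, fun j => mul_nonneg hV.le (hw j), hy, ?_⟩
  intro p hp
  have hint : ∀ α, IntegrableOn (fun x => Φ x α) D := fun α =>
    ((continuous_pi_iff.1 hΦ α).continuousOn).integrableOn_compact hDc
  have hmom : ∀ α, ∫ x in D, Φ x α = ∑ j, volume.real D * w j * Φ (y j) α := by
    intro α
    have h1 := congrFun h α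
    rw [setAverage_eq, Pi.smul_apply, eval_integral hint, smul_eq_mul,
      inv_mul_eq_iff_eq_mul₀ hV.ne'] at h1
    rw [h1, Finset.sum_apply, Finset.mul_sum]
    simp [mul_assoc]
  let idx : (Fin d →₀ ℕ) → (Fin d → Fin (m + 1)) := fun α i => Fin.ofNat (m + 1) (α i)
  have heval : ∀ x : E d, MvPolynomial.eval (fun i => x i) p =
      ∑ α ∈ p.support, p.coeff α * Φ x (idx α) := by
    intro x
    rw [MvPolynomial.eval_eq']
    refine Finset.sum_congr rfl fun α hα => ?_
    congr 1
    refine Finset.prod_congr rfl fun i _ => ?_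
    have hle : α i ≤ m := (MvPolynomial.monomial_le_degreeOf i hα).trans
      ((MvPolynomial.degreeOf_le_totalDegree p i).trans hp)
    simp [idx, Nat.mod_eq_of_lt (Nat.lt_succ_of_le hle)]
  simp_rw [heval]
  rw [integral_finsetSum _ fun α _ => (hint _).const_mul _]
  simp_rw [integral_const_mul, hmom, Finset.mul_sum]
  rw [Finset.sum_comm]
  refine Finset.sum_congr rfl fun j _ => Finset.sum_congr rfl fun α _ => by ring

/-- A polynomial with vanishing `L²` norm over a compact set with interior points is zero. -/
theorem eq_zero_of_integral_sq_eq_zero {d : ℕ} {D : Set (E d)} (hDc : IsCompact D)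
    (hDi : (interior D).Nonempty) (p : MvPolynomial (Fin d) ℝ)
    (h : ∫ y in D, (MvPolynomial.eval (fun i => y i) p) ^ 2 = 0) : p = 0 := by
  have hcont : Continuous fun y : E d => (MvPolynomial.eval (fun i => y i) p) ^ 2 :=
    (continuous_eval_polynomial p).pow 2
  rw [integral_eq_zero_iff_of_nonneg (fun _ => sq_nonneg _)
    (hcont.continuousOn.integrableOn_compact hDc)] at h
  have hzero : EqOn (fun y : E d => (MvPolynomial.eval (fun i => y i) p) ^ 2) 0 (interior D) :=
    Measure.eqOn_open_of_ae_eq (ae_restrict_of_ae_restrict_of_subset interior_subset h)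
      isOpen_interior hcont.continuousOn continuousOn_const
  obtain ⟨a, ha⟩ := hDi
  have hopen : IsOpen ((WithLp.toLp 2 : (Fin d → ℝ) → E d) ⁻¹' interior D) :=
    isOpen_interior.preimage (PiLp.continuous_toLp 2 _)
  obtain ⟨ε, hε, hball⟩ := Metric.isOpen_iff.1 hopen (fun i => a i) ha
  refine MvPolynomial.funext_set (fun i => Metric.ball (a i) ε)
    (fun i => by rw [Real.ball_eq_Ioo]; exact Ioo_infinite (by linarith)) fun x hx => ?_
  rw [← ball_pi _ hε] at hx
  simpa using hzero (hball hx)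

theorem bddBelow_christoffel (d n : ℕ) (x : E d) (D : Set (E d)) :
    BddBelow { r : ℝ | ∃ p : MvPolynomial (Fin d) ℝ, p.totalDegree ≤ n ∧
      MvPolynomial.eval (fun i => x i) p = 1 ∧
      r = ∫ y in D, (MvPolynomial.eval (fun i => y i) p) ^ 2 } := by
  refine ⟨0, ?_⟩
  rintro r ⟨p, -, -, rfl⟩
  exact integral_nonneg fun _ => sq_nonneg _

theorem nonempty_christoffel (d n : ℕ) (x : E d) (D : Set (E d)) :
    { r : ℝ | ∃ p : MvPolynomial (Fin d) ℝ, p.totalDegree ≤ n ∧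
      MvPolynomial.eval (fun i => x i) p = 1 ∧
      r = ∫ y in D, (MvPolynomial.eval (fun i => y i) p) ^ 2 }.Nonempty :=
  ⟨_, 1, by simp, by simp, rfl⟩

theorem totalDegree_sq_le {d n m : ℕ} {p : MvPolynomial (Fin d) ℝ} (hp : p.totalDegree ≤ n)
    (hm : 2 * n ≤ m) : (p ^ 2).totalDegree ≤ m :=
  (MvPolynomial.totalDegree_pow p 2).trans ((Nat.mul_le_mul_left 2 hp).trans hm)

theorem christoffel_pos {d : ℕ} {D : Set (E d)} (hDc : IsCompact D)
    (hDi : (interior D).Nonempty) (n : ℕ) (x : E d) : 0 < christoffel d n x D := by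
  have hD : volume D ≠ 0 := (Measure.measure_pos_of_nonempty_interior _ hDi).ne'
  obtain ⟨N, w, y, -, hw, -, hq⟩ := exists_quadrature hDc hD (2 * n)
  let P := MvPolynomial.restrictTotalDegree (Fin d) ℝ n
  have hsq : ∀ p : MvPolynomial (Fin d) ℝ, p.totalDegree ≤ n →
      ∫ z in D, (MvPolynomial.eval (fun i => z i) p) ^ 2 =
        ∑ j, (Real.sqrt (w j) * MvPolynomial.eval (fun i => y j i) p) ^ 2 := by
    intro p hp
    have := hq (p ^ 2) (totalDegree_sq_le hp le_rfl)
    simp only [map_pow] at this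
    rw [this]
    exact Finset.sum_congr rfl fun j _ => by rw [mul_pow, Real.sq_sqrt (hw j)]
  let T : P →ₗ[ℝ] (Fin N → ℝ) := (LinearMap.pi fun j =>
    Real.sqrt (w j) • (MvPolynomial.aeval (R := ℝ) (fun i => y j i)).toLinearMap) ∘ₗ P.subtype
  have hT : ∀ p : P, ∀ j, T p j =
      Real.sqrt (w j) * MvPolynomial.eval (fun i => y j i) (p : MvPolynomial (Fin d) ℝ) := by
    intro p j
    simp [T, MvPolynomial.aeval_eq_eval]
  have hker : LinearMap.ker T = ⊥ := by
    refine LinearMap.ker_eq_bot'.2 fun p hp => Subtype.ext ?_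
    refine eq_zero_of_integral_sq_eq_zero hDc hDi _ ?_
    rw [hsq _ ((MvPolynomial.mem_restrictTotalDegree _ _ _).1 p.2)]
    exact Finset.sum_eq_zero fun j _ => by rw [← hT, hp]; simp
  obtain ⟨g, hg⟩ := T.exists_leftInverse_of_injective hker
  let L : (Fin N → ℝ) →ₗ[ℝ] ℝ :=
    (MvPolynomial.aeval (R := ℝ) (fun i => x i)).toLinearMap ∘ₗ P.subtype ∘ₗ g
  set C := ∑ j, L (Pi.single j 1) ^ 2
  have hbound : ∀ p : MvPolynomial (Fin d) ℝ, p.totalDegree ≤ n →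
      MvPolynomial.eval (fun i => x i) p = 1 →
      1 ≤ (∫ z in D, (MvPolynomial.eval (fun i => z i) p) ^ 2) * C := by
    intro p hp hpx
    have hpP : p ∈ P := (MvPolynomial.mem_restrictTotalDegree _ _ _).2 hp
    have h1 : L (T ⟨p, hpP⟩) = 1 := by
      have : g (T ⟨p, hpP⟩) = ⟨p, hpP⟩ := LinearMap.congr_fun hg _
      simp [L, this, MvPolynomial.aeval_eq_eval, hpx]
    have h2 : L (T ⟨p, hpP⟩) = ∑ j, T ⟨p, hpP⟩ j * L (Pi.single j 1) := by
      rw [LinearMap.pi_apply_eq_sum_univ L]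
      refine Finset.sum_congr rfl fun j _ => ?_
      rw [smul_eq_mul]
      congr 2
      ext k
      simp [Pi.single_apply, eq_comm]
    have h3 := Finset.sum_mul_sq_le_sq_mul_sq Finset.univ (T ⟨p, hpP⟩)
      (fun j => L (Pi.single j 1))
    rw [← h2, h1] at h3
    simp only [hT] at h3
    rw [hsq p hp]
    simpa using h3
  have hC0 : 0 ≤ C := Finset.sum_nonneg fun j _ => sq_nonneg _
  have hC : 0 < C := by
    refine hC0.lt_of_ne fun h => ?_
    have := hbound 1 (by simp) (by simp)
    rw [← h, mul_zero] at this
    linarith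
  refine (inv_pos.2 hC).trans_le (le_csInf (nonempty_christoffel d n x D) ?_)
  rintro r ⟨p, hp, hpx, rfl⟩
  rw [inv_le_iff_one_le_mul₀ hC]
  exact hbound p hp hpx

/-- Sampling at the nodes of a positive quadrature formula of degree `4 * n` controls polynomials
of degree `n` up to the ratio of Christoffel functions. -/
theorem sq_eval_mul_christoffel_le {d n N : ℕ} {D : Set (E d)} {w : Fin N → ℝ}
    {y : Fin N → E d} (hw : ∀ j, 0 ≤ w j)
    (hq : ∀ p : MvPolynomial (Fin d) ℝ, p.totalDegree ≤ 4 * n →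
      ∫ x in D, MvPolynomial.eval (fun i => x i) p =
        ∑ j, w j * MvPolynomial.eval (fun i => y j i) p)
    {p : MvPolynomial (Fin d) ℝ} (hp : p.totalDegree ≤ n) {M : ℝ}
    (hM : ∀ j, |MvPolynomial.eval (fun i => y j i) p| ≤ M) (z : E d) :
    (MvPolynomial.eval (fun i => z i) p) ^ 2 * christoffel d (2 * n) z D ≤
      M ^ 2 * christoffel d n z D := by
  set t := MvPolynomial.eval (fun i => z i) p with ht
  rw [christoffel, christoffel, ← smul_eq_mul (M ^ 2),
    ← Real.sInf_smul_of_nonneg (sq_nonneg M)]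
  refine le_csInf (nonempty_christoffel d n z D).smul_set ?_
  rintro _ ⟨_, ⟨q, hqn, hqz, rfl⟩, rfl⟩
  simp only [smul_eq_mul]
  have hqq := hq (q ^ 2) (totalDegree_sq_le hqn (by lia))
  have hpq : (p * q).totalDegree ≤ 2 * n :=
    (MvPolynomial.totalDegree_mul p q).trans (by lia)
  have hpqq := hq ((p * q) ^ 2) (totalDegree_sq_le hpq (by lia))
  simp only [map_pow, map_mul] at hqq hpqq
  have hle : ∫ x in D, (MvPolynomial.eval (fun i => x i) p *
      MvPolynomial.eval (fun i => x i) q) ^ 2 ≤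
      M ^ 2 * ∫ x in D, (MvPolynomial.eval (fun i => x i) q) ^ 2 := by
    rw [hqq, hpqq, Finset.mul_sum]
    refine Finset.sum_le_sum fun j _ => ?_
    rw [mul_pow, mul_left_comm (M ^ 2)]
    have := sq_le_sq' (neg_le_of_abs_le (hM j)) (le_of_abs_le (hM j))
    gcongr
    exact hw j
  refine le_trans ?_ hle
  rcases eq_or_ne t 0 with h0 | h0
  · rw [h0, zero_pow two_ne_zero, zero_mul]
    exact integral_nonneg fun _ => sq_nonneg _
  · rw [← le_div_iff₀' (by positivity)]
    refine csInf_le (bddBelow_christoffel d (2 * n) z D) ⟨MvPolynomial.C t⁻¹ * (p * q), ?_, ?_, ?_⟩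
    · refine (MvPolynomial.totalDegree_mul _ _).trans ?_
      simpa using hpq
    · simp [hqz, ← ht, h0]
    · rw [div_eq_inv_mul, ← integral_const_mul]
      refine integral_congr_ae (Filter.Eventually.of_forall fun x => ?_)
      simp only [map_mul, MvPolynomial.eval_C]
      ring

/-- Proposition 4.2: comparability of `λ_n` and `λ_{2n}` implies optimal polynomial meshes. -/
theorem stmt7 (d : ℕ) (D : Set (E d)) (hDc : IsCompact D) (hDi : (interior D).Nonempty)
    (c : ℝ) (hc : 0 < c)
    (hcomp : ∀ n : ℕ, 1 ≤ n → ∀ x ∈ D, christoffel d n x D ≤ c * christoffel d (2 * n) x D) :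
    ∃ μ ν : ℝ, 0 < μ ∧ 0 < ν ∧ ∀ n : ℕ, 1 ≤ n → ∃ Y : Finset (E d),
      ↑Y ⊆ D ∧ (Y.card : ℝ) ≤ μ * (n : ℝ) ^ d ∧
      ∀ p : MvPolynomial (Fin d) ℝ, p.totalDegree ≤ n → ∀ z ∈ D,
        |MvPolynomial.eval (fun i => z i) p| ≤
          ν * sSup ((fun y : E d => |MvPolynomial.eval (fun i => y i) p|) '' ↑Y) := by
  have hD : volume D ≠ 0 := (Measure.measure_pos_of_nonempty_interior _ hDi).ne'
  refine ⟨2 * 5 ^ d, Real.sqrt c, by positivity, Real.sqrt_pos.2 hc, fun n hn => ?_⟩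
  obtain ⟨N, w, y, hN, hw, hy, hq⟩ := exists_quadrature hDc hD (4 * n)
  classical
  refine ⟨Finset.univ.image y, ?_, ?_, fun p hp z hz => ?_⟩
  · intro v hv
    obtain ⟨j, -, rfl⟩ := Finset.mem_image.1 (Finset.mem_coe.1 hv)
    exact hy j
  · have h1 : (Finset.univ.image y).card ≤ N := by
      simpa using Finset.card_image_le (s := Finset.univ) (f := y)
    have h2 : (4 * n + 1) ^ d ≤ (5 * n) ^ d := Nat.pow_le_pow_left (by lia) d
    have h3 : 1 ≤ (5 * n) ^ d := Nat.one_le_pow _ _ (by lia)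
    have h4 : (Finset.univ.image y).card ≤ 2 * 5 ^ d * n ^ d := by
      rw [mul_assoc, ← mul_pow]
      linarith
    exact_mod_cast h4
  · set M := sSup ((fun v : E d => |MvPolynomial.eval (fun i => v i) p|) ''
      ↑(Finset.univ.image y))
    have hM0 : 0 ≤ M := Real.sSup_nonneg (by rintro _ ⟨v, -, rfl⟩; exact abs_nonneg _)
    have hM : ∀ j, |MvPolynomial.eval (fun i => y j i) p| ≤ M := fun j =>
      le_csSup ((Finset.finite_toSet _).image _).bddAbove ⟨y j, by simp, rfl⟩
    have hpos := christoffel_pos hDc hDi (2 * n) z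
    have h := (sq_eval_mul_christoffel_le hw hq hp hM z).trans
      (mul_le_mul_of_nonneg_left (hcomp n hn z hz) (sq_nonneg M))
    rw [← mul_assoc] at h
    have h' := le_of_mul_le_mul_right h hpos
    refine abs_le_of_sq_le_sq (h'.trans_eq ?_) (by positivity)
    rw [mul_pow, Real.sq_sqrt hc.le, mul_comm]
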